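/- arXiv:2605.01786 — 2 statements merged into one kernel-verified Lean document; each statement's English description precedes it below -/
import Mathlib

section
/- The number of triples (x₁, x₂, x₃) ∈ K³ satisfying x₁ + x₂ + x₃ = 0 and x₁^d + x₂^d + x₃^d = 0 equals 3·p^n − 2 + (p^n − 1)·(p^m + (s₁ − 1)(s₁ − 2) + (s₂ − 1)(s₂ − 2) − 2). -/
theorem aux_roots {K : Type} [Field K] [Fintype K] [DecidableEq K] (g : ℕ)
    (hdvd : g ∣ Fintype.card K - 1) :
    (Finset.univ.filter (fun x : K => x ^ g = 1)).card = g := by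
  classical
  have hc : 0 < Fintype.card K - 1 := by
    have := Fintype.one_lt_card (α := K); omega
  have hg : 0 < g := Nat.pos_of_dvd_of_pos hdvd hc
  have h1 : Nat.card Kˣ = Fintype.card K - 1 := by
    rw [Nat.card_eq_fintype_card, Fintype.card_units]
  obtain ⟨z, hz⟩ := IsCyclic.exists_generator (α := Kˣ)
  have hz1 : orderOf z = Fintype.card K - 1 := by
    rw [orderOf_eq_card_of_forall_mem_zpowers hz, h1]
  have hz2 : IsPrimitiveRoot z (Fintype.card K - 1) := hz1 ▸ IsPrimitiveRoot.orderOf z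
  obtain ⟨k, hk⟩ := hdvd
  have hz3 : IsPrimitiveRoot (z ^ k) g := hz2.pow hc (by rw [hk, mul_comm])
  have hz4 : IsPrimitiveRoot ((z ^ k : Kˣ) : K) g := IsPrimitiveRoot.coe_units_iff.2 hz3
  have h2 := hz4.card_nthRootsFinset
  refine Eq.trans ?_ h2
  congr 1
  ext x
  simp [Polynomial.mem_nthRootsFinset hg]

theorem aux_alg {K : Type} [Field K] (u v a b : K) (hu : u ≠ 0) (hv : v ≠ 0)
    (ha : a ≠ 0) (hb : b ≠ 0) (hu1 : u ≠ 1) (hv1 : v ≠ 1) (huv : u ≠ v)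
    (e1 : (u - 1) * (b * v - 1) = (v - 1) * (a * u - 1))
    (e2 : (u⁻¹ - 1) * (b⁻¹ * v⁻¹ - 1) = (v⁻¹ - 1) * (a⁻¹ * u⁻¹ - 1)) :
    (a * u = 1 ∧ b * v = 1) ∨ (a = 1 ∧ b = 1) := by
  have hu1' := sub_ne_zero.2 hu1
  have hv1' := sub_ne_zero.2 hv1
  have huv' := sub_ne_zero.2 huv
  have e3 : (u - 1) * (b * v - 1) * a = (v - 1) * (a * u - 1) * b := by
    field_simp at e2
    have : (u * v) * ((u - 1) * (b * v - 1) * a - (v - 1) * (a * u - 1) * b) = 0 := by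
      linear_combination (u*v) * e2
    rcases mul_eq_zero.1 this with h | h
    · exact absurd h (mul_ne_zero hu hv)
    · exact sub_eq_zero.1 h
  have e4 : (u - 1) * (b * v - 1) * (a - b) = 0 := by
    linear_combination e3 - b * e1
  rcases mul_eq_zero.1 e4 with h | h
  · left
    have h1 : b * v - 1 = 0 := (mul_eq_zero.1 h).resolve_left hu1'
    have h2 : a * u - 1 = 0 := by
      rw [h1, mul_zero] at e1
      exact (mul_eq_zero.1 e1.symm).resolve_left hv1'
    exact ⟨sub_eq_zero.1 h2, sub_eq_zero.1 h1⟩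
  · right
    have hab : a = b := sub_eq_zero.1 h
    subst hab
    have : (u - v) * (a - 1) = 0 := by linear_combination e1
    have := sub_eq_zero.1 ((mul_eq_zero.1 this).resolve_left huv')
    exact ⟨this, this⟩

theorem aux_scale {K : Type} [Field K] [Fintype K] [DecidableEq K] (d : ℕ) (hd : 0 < d)
    (hneg : (-1 : K) ^ d = -1) :
    Nat.card {t : K × K × K //
        t.1 + t.2.1 + t.2.2 = 0 ∧ t.1 ^ d + t.2.1 ^ d + t.2.2 ^ d = 0}
      = Fintype.card K + (Fintype.card K - 1) *
        (Finset.univ.filter (fun x : K => x ^ d + (1 - x) ^ d = 1)).card := by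
  have hneg' : ∀ x : K, (-x) ^ d = - x ^ d := fun x => by
    rw [← neg_one_mul x, mul_pow, hneg, neg_one_mul]
  have e : {t : K × K × K //
        t.1 + t.2.1 + t.2.2 = 0 ∧ t.1 ^ d + t.2.1 ^ d + t.2.2 ^ d = 0} ≃
      K ⊕ (Kˣ × {x : K // x ^ d + (1 - x) ^ d = 1}) := by
    symm
    refine Equiv.ofBijective (Sum.elim (fun a => ⟨(a, -a, 0), ?_, ?_⟩)
      (fun c => ⟨((c.1 : K) * c.2.1, (c.1 : K) * (1 - c.2.1), -(c.1 : K)), ?_, ?_⟩)) ⟨?_, ?_⟩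
    · simp
    · simp [hneg', hd.ne']
    · simp only; ring
    · have := c.2.2
      simp only [hneg', mul_pow]
      linear_combination (c.1 : K) ^ d * this
    · rintro (a | ⟨c, x, hx⟩) (b | ⟨c', x', hx'⟩) h
      · simp at h; simp [h]
      · simp at h
      · simp at h
      · simp only [Sum.elim_inr, Subtype.mk.injEq, Prod.mk.injEq, neg_inj] at h
        obtain ⟨h1, h2, h3⟩ := h
        have h4 : c = c' := Units.ext h3
        subst h4
        have h5 : x = x' := mul_left_cancel₀ c.ne_zero h1
        subst h5
        rfl
    · rintro ⟨⟨a, b, c⟩, h1, h2⟩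
      simp only at h1 h2
      by_cases hc : c = 0
      · subst hc
        refine ⟨Sum.inl a, ?_⟩
        simp only [Sum.elim_inl, Subtype.mk.injEq, Prod.mk.injEq, true_and, and_true]
        linear_combination -h1
      · have hb : b = -a - c := by linear_combination h1
        subst hb
        have hc' : -c ≠ 0 := neg_ne_zero.2 hc
        have k2 : -c * (1 - a / (-c)) = -a - c := by field_simp; ring
        refine ⟨Sum.inr (Units.mk0 (-c) hc', ⟨a / (-c), ?_⟩), ?_⟩
        · have k1 : (-c) * (a / (-c)) = a := by field_simp
          have hcd : (-c) ^ d ≠ 0 := pow_ne_zero _ hc'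
          apply mul_left_cancel₀ hcd
          rw [mul_add, ← mul_pow, ← mul_pow, k1, k2, mul_one, hneg']
          linear_combination h2
        · simp only [Sum.elim_inr, Subtype.mk.injEq, Prod.mk.injEq, Units.val_mk0, neg_neg, and_true]
          exact ⟨by field_simp, k2⟩
  rw [Nat.card_congr e, Nat.card_eq_fintype_card, Fintype.card_sum, Fintype.card_prod,
    Fintype.card_units, Fintype.card_subtype]

theorem aux_count {K : Type} [Field K] [Fintype K] [DecidableEq K] (p m s : ℕ) (hp : p.Prime)
    (hm : 0 < m) (hs : 0 < s) (hK : Fintype.card K = p ^ (2 * m)) (d : ℕ)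
    (hd : d = s * (p ^ m - 1) + 1) :
    (Finset.univ.filter (fun x : K => x ^ d + (1 - x) ^ d = 1)).card
      = p ^ m + (Nat.gcd s (p ^ m + 1) - 1) * (Nat.gcd s (p ^ m + 1) - 2)
        + (Nat.gcd (s - 1) (p ^ m + 1) - 1) * (Nat.gcd (s - 1) (p ^ m + 1) - 2) := by
  have : Fact p.Prime := ⟨hp⟩
  have : CharP K p := charP_of_card_eq_prime_pow hK
  obtain ⟨φ, hφ⟩ : ∃ φ : K →+* K, ∀ x, φ x = x ^ (p ^ m) :=
    ⟨iterateFrobenius K p m, fun x => iterateFrobenius_def ..⟩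
  have hq2 : 2 ≤ p ^ m := hp.two_le.trans (Nat.le_self_pow hm.ne' p)
  have hK' : Fintype.card K = p ^ m * p ^ m := by rw [hK, two_mul, pow_add]
  generalize p ^ m = q at *
  obtain ⟨r, rfl⟩ : ∃ r, q = r + 1 := ⟨q - 1, by omega⟩
  simp only [Nat.add_sub_cancel] at hd
  have hK1 : Fintype.card K - 1 = r * (r + 1 + 1) := by
    rw [hK']; apply Nat.sub_eq_of_eq_add; ring
  have hφd : ∀ x : K, x ^ d = x * (x ^ r) ^ s := fun x => by
    rw [hd, pow_succ', ← pow_mul, mul_comm s]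
  have hφr : ∀ x : K, φ x = x * x ^ r := fun x => by rw [hφ, pow_succ']
  have hU : ∀ x : K, x ≠ 0 → (x ^ r) ^ (r + 1 + 1) = 1 := fun x hx => by
    rw [← pow_mul, ← hK1]; exact FiniteField.pow_card_sub_one_eq_one x hx
  have hr1 : ∀ x : K, x ≠ 0 → (φ x = x ↔ x ^ r = 1) := fun x hx => by
    rw [hφr]; exact mul_eq_left₀ hx
  have hinv : ∀ u : K, u ^ (r + 1 + 1) = 1 → φ u = u⁻¹ := fun u hu => by
    rw [hφ]; apply eq_inv_of_mul_eq_one_left; rw [← pow_succ, hu]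
  -- split
  rw [← Finset.card_filter_add_card_filter_not (p := fun x : K => φ x = x), Finset.filter_filter,
    Finset.filter_filter, add_assoc]
  congr 1
  · have : (Finset.univ.filter (fun x : K => x ^ d + (1 - x) ^ d = 1 ∧ φ x = x))
        = insert 0 (Finset.univ.filter (fun x : K => x ^ r = 1)) := by
      ext x
      simp only [Finset.mem_filter, Finset.mem_univ, true_and, Finset.mem_insert]
      have key : ∀ x : K, φ x = x → x ^ d = x := fun x hx => by
        rw [hφd]
        rcases eq_or_ne x 0 with rfl | h0
        · simp
        · rw [(hr1 x h0).1 hx]; simp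
      constructor
      · rintro ⟨-, h⟩
        rcases eq_or_ne x 0 with rfl | h0
        · simp
        · exact Or.inr ((hr1 x h0).1 h)
      · intro h
        have hx : φ x = x := by
          rcases h with rfl | h
          · simp
          · rw [hφr, h, mul_one]
        refine ⟨?_, hx⟩
        rw [key x hx, key (1 - x) (by simp [hx])]; ring
    rw [this, Finset.card_insert_of_notMem, aux_roots r ⟨_, hK1⟩]
    simp only [Finset.mem_filter, Finset.mem_univ, true_and]
    rw [zero_pow (by omega)]
    exact zero_ne_one
  · set R : ℕ → Finset K := fun g => (Finset.univ.filter (fun x : K => x ^ g = 1)).erase 1 with hR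
    have memR : ∀ (k : ℕ) (u : K), u ∈ R (Nat.gcd k (r + 1 + 1)) ↔
        u ≠ 1 ∧ u ^ k = 1 ∧ u ^ (r + 1 + 1) = 1 := fun k u => by
      simp only [hR, Finset.mem_erase, Finset.mem_filter, Finset.mem_univ, true_and]
      refine and_congr_right fun _ => ⟨fun h => ⟨?_, ?_⟩, fun h => pow_gcd_eq_one.2 h⟩
      · obtain ⟨c, hc⟩ := Nat.gcd_dvd_left k (r + 1 + 1)
        rw [hc, pow_mul, h, one_pow]
      · obtain ⟨c, hc⟩ := Nat.gcd_dvd_right k (r + 1 + 1)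
        conv_lhs => rw [hc]
        rw [pow_mul, h, one_pow]
    have cardR : ∀ k : ℕ, (R (Nat.gcd k (r + 1 + 1))).offDiag.card =
        (Nat.gcd k (r + 1 + 1) - 1) * (Nat.gcd k (r + 1 + 1) - 2) := fun k => by
      rw [Finset.offDiag_card, hR]
      simp only
      rw [Finset.card_erase_of_mem (by simp), aux_roots]
      · generalize Nat.gcd k (r + 1 + 1) = g
        rw [show g - 2 = (g - 1) - 1 by omega, Nat.mul_sub (g - 1) (g - 1) 1, mul_one]
      · rw [hK1]; exact (Nat.gcd_dvd_right _ _).mul_left _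
    rw [← cardR, ← cardR, ← Finset.card_union_of_disjoint]
    swap
    · rw [Finset.disjoint_left]
      rintro ⟨u, v⟩ h1 h2
      rw [Finset.mem_offDiag] at h1 h2
      have h3 := (memR _ _).1 h1.1
      have h4 := (memR _ _).1 h2.1
      apply h3.1
      have h5 := h3.2.1
      obtain ⟨t, rfl⟩ : ∃ t, s = t + 1 := ⟨s - 1, by omega⟩
      simp only [Nat.add_sub_cancel] at h4
      simpa [pow_succ, h4.2.1] using h5
    have facts : ∀ x : K, φ x ≠ x → x ≠ 0 ∧ 1 - x ≠ 0 ∧ x ^ r ≠ 1 ∧ (1 - x) ^ r ≠ 1 ∧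
        x ^ r ≠ (1 - x) ^ r ∧ x * (x ^ r - (1 - x) ^ r) = 1 - (1 - x) ^ r := fun x hx => by
      have h0 : x ≠ 0 := by rintro rfl; simp at hx
      have h1 : 1 - x ≠ 0 := fun h => by
        rw [← sub_eq_zero.1 h] at hx; simp at hx
      have hu1 : x ^ r ≠ 1 := fun h => hx ((hr1 x h0).2 h)
      have hv1 : (1 - x) ^ r ≠ 1 := fun h => hx (by
        have := (hr1 _ h1).2 h
        rw [map_sub, map_one] at this
        linear_combination -this)
      have h2 : x * x ^ r + (1 - x) * (1 - x) ^ r = 1 := by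
        rw [← hφr, ← hφr, map_sub, map_one]; ring
      refine ⟨h0, h1, hu1, hv1, ?_, by linear_combination h2⟩
      intro h
      apply hu1
      rw [← h] at h2
      linear_combination h2
    have rev : ∀ u v : K, (u, v) ∈ (R (Nat.gcd s (r + 1 + 1))).offDiag ∪
        (R (Nat.gcd (s - 1) (r + 1 + 1))).offDiag →
        ((1 - v) / (u - v)) ^ r = u ∧ (1 - (1 - v) / (u - v)) ^ r = v ∧
        φ ((1 - v) / (u - v)) ≠ (1 - v) / (u - v) ∧
        ((1 - v) / (u - v)) ^ d + (1 - (1 - v) / (u - v)) ^ d = 1 := by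
      intro u v h
      have h' : u ≠ 1 ∧ v ≠ 1 ∧ u ≠ v ∧ u ^ (r + 1 + 1) = 1 ∧ v ^ (r + 1 + 1) = 1 ∧
          u ^ s * (1 - v) + v ^ s * (u - 1) = u - v := by
        simp only [Finset.mem_union, Finset.mem_offDiag, memR] at h
        rcases h with ⟨⟨a1, a2, a3⟩, ⟨b1, b2, b3⟩, c⟩ | ⟨⟨a1, a2, a3⟩, ⟨b1, b2, b3⟩, c⟩
        · refine ⟨a1, b1, c, a3, b3, ?_⟩
          rw [a2, b2]; ring
        · refine ⟨a1, b1, c, a3, b3, ?_⟩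
          obtain ⟨t, rfl⟩ : ∃ t, s = t + 1 := ⟨s - 1, by omega⟩
          simp only [Nat.add_sub_cancel] at a2 b2
          rw [pow_succ, pow_succ, a2, b2]; ring
      obtain ⟨hu1, hv1, huv, hu, hv, hE⟩ := h'
      have hu0 : u ≠ 0 := by rintro rfl; simp at hu
      have hv0 : v ≠ 0 := by rintro rfl; simp at hv
      have huv' := sub_ne_zero.2 huv
      have hvu' := sub_ne_zero.2 huv.symm
      have hx0 : (1 - v) / (u - v) ≠ 0 := div_ne_zero (sub_ne_zero.2 hv1.symm) huv'
      have hy : 1 - (1 - v) / (u - v) = (u - 1) / (u - v) := by field_simp; ring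
      have hy0 : (u - 1) / (u - v) ≠ 0 := div_ne_zero (sub_ne_zero.2 hu1) huv'
      have hinvs : u⁻¹ - v⁻¹ = (v - u) / (u * v) := by field_simp
      have hx : ((1 - v) / (u - v)) ^ r = u := by
        apply mul_left_cancel₀ hx0
        rw [← hφr, map_div₀, map_sub, map_sub, map_one, hinv u hu, hinv v hv, hinvs]
        field_simp
        ring
      have hyr : ((u - 1) / (u - v)) ^ r = v := by
        apply mul_left_cancel₀ hy0
        rw [← hφr, map_div₀, map_sub, map_sub, map_one, hinv u hu, hinv v hv, hinvs]
        field_simp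
        ring
      refine ⟨hx, hy ▸ hyr, ?_, ?_⟩
      · rw [Ne, hr1 _ hx0, hx]; exact hu1
      · rw [hy, hφd, hφd, hx, hyr]
        field_simp
        linear_combination hE
    refine Finset.card_nbij' (fun x => (x ^ r, (1 - x) ^ r)) (fun w => (1 - w.2) / (w.1 - w.2))
      ?_ ?_ ?_ ?_
    · intro x hx
      simp only [Finset.coe_filter, Finset.mem_univ, true_and, Set.mem_ofPred_eq] at hx
      obtain ⟨hT, hF⟩ := hx
      obtain ⟨h0, h1, hu1, hv1, huv, h2⟩ := facts x hF
      have hu := hU x h0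
      have hv := hU _ h1
      rw [hφd, hφd] at hT
      have hu0 : x ^ r ≠ 0 := pow_ne_zero _ h0
      have hv0 : (1 - x) ^ r ≠ 0 := pow_ne_zero _ h1
      simp only [Finset.coe_union, Set.mem_union, Finset.mem_coe, Finset.mem_offDiag, memR]
      generalize x ^ r = u at *
      generalize (1 - x) ^ r = v at *
      obtain ⟨t, rfl⟩ : ∃ t, s = t + 1 := ⟨s - 1, by omega⟩
      simp only [Nat.add_sub_cancel]
      have e1 : (u - 1) * (v ^ t * v - 1) = (v - 1) * (u ^ t * u - 1) := by
        rw [← pow_succ, ← pow_succ]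
        have h3 : x * (u ^ (t + 1) - v ^ (t + 1)) = 1 - v ^ (t + 1) := by linear_combination hT
        linear_combination (u - v) * h3 - (u ^ (t + 1) - v ^ (t + 1)) * h2
      have e2 := congrArg φ e1
      simp only [map_mul, map_sub, map_one, map_pow, hinv u hu, hinv v hv] at e2
      rw [inv_pow, inv_pow] at e2
      rcases aux_alg u v _ _ hu0 hv0 (pow_ne_zero t hu0) (pow_ne_zero t hv0) hu1 hv1 huv e1 e2
        with ⟨h3, h4⟩ | ⟨h3, h4⟩
      · rw [← pow_succ] at h3 h4
        exact Or.inl ⟨⟨hu1, h3, hu⟩, ⟨hv1, h4, hv⟩, huv⟩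
      · exact Or.inr ⟨⟨hu1, h3, hu⟩, ⟨hv1, h4, hv⟩, huv⟩
    · rintro ⟨u, v⟩ h
      obtain ⟨-, -, h3, h4⟩ := rev u v (Finset.mem_coe.1 h)
      simp only [Finset.coe_filter, Finset.mem_univ, true_and, Set.mem_ofPred_eq]
      exact ⟨h4, h3⟩
    · intro x hx
      simp only [Finset.coe_filter, Finset.mem_univ, true_and, Set.mem_ofPred_eq] at hx
      obtain ⟨h0, h1, hu1, hv1, huv, h2⟩ := facts x hx.2
      simp only
      rw [div_eq_iff (sub_ne_zero.2 huv), h2]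
    · rintro ⟨u, v⟩ h
      obtain ⟨h1, h2, -, -⟩ := rev u v (Finset.mem_coe.1 h)
      simp only [h1, h2]

/-- the number of triples `(x₁,x₂,x₃) ∈ K³`, `K = GF(p^(2m))`,
with `x₁+x₂+x₃ = 0` and `x₁^d+x₂^d+x₃^d = 0` (where `d = s(p^m-1)+1`) equals
`3p^n - 2 + (p^n-1)(p^m + (s₁-1)(s₁-2) + (s₂-1)(s₂-2) - 2)` with `n = 2m`,
`s₁ = gcd(s, p^m+1)`, `s₂ = gcd(s-1, p^m+1)`. -/
theorem stmt_7 (p m s : ℕ) (hp : p.Prime) (hm : 0 < m) (hs : 0 < s)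
    (K : Type) [Field K] [Fintype K] (hK : Fintype.card K = p ^ (2 * m))
    (d : ℕ) (hd : d = s * (p ^ m - 1) + 1) :
    Nat.card {t : K × K × K //
        t.1 + t.2.1 + t.2.2 = 0 ∧ t.1 ^ d + t.2.1 ^ d + t.2.2 ^ d = 0}
      = 3 * p ^ (2 * m) - 2
        + (p ^ (2 * m) - 1) *
            (p ^ m
              + (Nat.gcd s (p ^ m + 1) - 1) * (Nat.gcd s (p ^ m + 1) - 2)
              + (Nat.gcd (s - 1) (p ^ m + 1) - 1) * (Nat.gcd (s - 1) (p ^ m + 1) - 2)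
              - 2) := by
  classical
  have hq2 : 2 ≤ p ^ m := hp.two_le.trans (Nat.le_self_pow hm.ne' p)
  have hneg : (-1 : K) ^ d = -1 := by
    rcases hp.eq_two_or_odd' with rfl | hodd
    · have : Fact (Nat.Prime 2) := ⟨hp⟩
      have : CharP K 2 := charP_of_card_eq_prime_pow hK
      rw [CharTwo.neg_eq, one_pow]
    · apply Odd.neg_one_pow
      rw [hd]
      have h1 : Odd (p ^ m) := hodd.pow
      have h2 : Even (p ^ m - 1) := Nat.Odd.sub_odd h1 odd_one
      exact (h2.mul_left s).add_one
  rw [aux_scale d (by omega) hneg, aux_count p m s hp hm hs hK d hd, hK]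
  generalize (Nat.gcd s (p ^ m + 1) - 1) * (Nat.gcd s (p ^ m + 1) - 2) = A
  generalize (Nat.gcd (s - 1) (p ^ m + 1) - 1) * (Nat.gcd (s - 1) (p ^ m + 1) - 2) = B
  have hQ : 1 ≤ p ^ (2 * m) := Nat.one_le_pow _ _ hp.pos
  generalize p ^ (2 * m) = Q at *
  generalize p ^ m = q at *
  obtain ⟨Q, rfl⟩ : ∃ Q', Q = Q' + 1 := ⟨Q - 1, by omega⟩
  obtain ⟨q, rfl⟩ : ∃ q', q = q' + 2 := ⟨q - 2, by omega⟩
  rw [show q + 2 + A + B - 2 = q + A + B by omega, show 3 * (Q + 1) - 2 = 3 * Q + 1 by omega,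
    Nat.add_sub_cancel]
  ring
end

section
/- The Walsh transform of F satisfies Σ_{u,v ∈ K} W_F(u,v)³ = p^{2n} · ( 3·p^n − 2 + (p^n − 1)·(p^m + (s₁ − 1)(s₁ − 2) + (s₂ − 1)(s₂ − 2) − 2) ). -/
theorem niho_count {K : Type} [Field K] [Fintype K] [DecidableEq K] (n : ℕ)
    (hn : n ∣ Fintype.card K - 1) :
    (Finset.univ.filter (fun x : K => x ^ n = 1)).card = n := by
  have h1 : 1 < Fintype.card K := Fintype.one_lt_card
  have hpos : 0 < n := Nat.pos_of_dvd_of_pos hn (by omega)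
  obtain ⟨g, hg⟩ := IsCyclic.exists_generator (α := Kˣ)
  have ho : orderOf g = Fintype.card K - 1 := by
    rw [orderOf_eq_card_of_forall_mem_zpowers hg, Nat.card_eq_fintype_card, Fintype.card_units]
  have hp : IsPrimitiveRoot (g : K) (Fintype.card K - 1) := by
    rw [← ho]; exact (IsPrimitiveRoot.orderOf g).map_of_injective (f := Units.coeHom K) Units.val_injective
  obtain ⟨k, hk⟩ := hn
  have hz := hp.pow (by omega) (show Fintype.card K - 1 = k * n by rw [hk, mul_comm])
  refine Eq.trans ?_ hz.card_nthRootsFinset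
  congr 1
  ext x
  simp [Polynomial.mem_nthRootsFinset hpos]

theorem niho_countS {K : Type} [Field K] [Fintype K] [DecidableEq K] (q t : ℕ)
    (hq : 1 < q) (hK : Fintype.card K = q ^ 2) :
    (Finset.univ.filter (fun x : K => x ^ t = 1 ∧ x ^ (q + 1) = 1)).card = Nat.gcd t (q + 1) := by
  have hf : q ^ 2 - 1 = (q + 1) * (q - 1) := by simpa using Nat.sq_sub_sq q 1
  rw [← niho_count (K := K) (Nat.gcd t (q + 1))
    (by rw [hK, hf]; exact (Nat.gcd_dvd_right _ _).mul_right _)]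
  congr 1
  ext x
  simp only [Finset.mem_filter, Finset.mem_univ, true_and]
  constructor
  · rintro ⟨h1, h2⟩
    exact pow_gcd_eq_one.2 ⟨h1, h2⟩
  · intro h
    obtain ⟨k, hk⟩ := Nat.gcd_dvd_left t (q + 1)
    obtain ⟨l, hl⟩ := Nat.gcd_dvd_right t (q + 1)
    constructor
    · rw [hk, pow_mul, h, one_pow]
    · rw [hl, pow_mul, h, one_pow]

theorem niho_countF {K : Type} [Field K] [Fintype K] [DecidableEq K] (q : ℕ)
    (hq : 1 < q) (hK : Fintype.card K = q ^ 2) :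
    (Finset.univ.filter (fun x : K => x ^ q = x)).card = q := by
  have hf : q ^ 2 - 1 = (q + 1) * (q - 1) := by simpa using Nat.sq_sub_sq q 1
  have h := niho_count (K := K) (q - 1) (by rw [hK, hf]; exact Dvd.intro_left _ rfl)
  have : (Finset.univ.filter (fun x : K => x ^ q = x))
      = insert 0 (Finset.univ.filter (fun x : K => x ^ (q - 1) = 1)) := by
    ext x
    simp only [Finset.mem_filter, Finset.mem_univ, true_and, Finset.mem_insert]
    by_cases hx : x = 0
    · simp [hx]; omega
    · obtain ⟨r, rfl⟩ : ∃ r, q = r + 1 := ⟨q - 1, by omega⟩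
      simp [hx, pow_succ]
  rw [this, Finset.card_insert_of_notMem, h]
  · clear hf; omega
  · have h0 : q - 1 ≠ 0 := by omega
    simp [zero_pow h0]

theorem niho_fwd {K : Type} [Field K] (q s d : ℕ) (hq : 1 < q) (hs : 0 < s)
    (hd : d = s * (q - 1) + 1) (hadd : ∀ x y : K, (x + y) ^ q = x ^ q + y ^ q)
    (hU : ∀ x : K, x ≠ 0 → (x ^ (q - 1)) ^ (q + 1) = 1)
    (x y : K) (hxy : x + y = 1) (hx : x ^ q ≠ x) (h : x ^ d + y ^ d = 1) :
    (x ≠ 0 ∧ y ≠ 0 ∧ x ^ (q - 1) ≠ 1 ∧ y ^ (q - 1) ≠ 1 ∧ x ^ (q - 1) ≠ y ^ (q - 1) ∧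
      x ^ (q - 1) * x + y ^ (q - 1) * y = 1) ∧
    (((x ^ (q - 1)) ^ s = 1 ∧ (y ^ (q - 1)) ^ s = 1) ∨
      ((x ^ (q - 1)) ^ (s - 1) = 1 ∧ (y ^ (q - 1)) ^ (s - 1) = 1)) := by
  have hqs : ∀ z : K, z ^ (q - 1) * z = z ^ q := fun z => by
    rw [← pow_succ]; congr 1; omega
  have hds : ∀ z : K, z ^ d = (z ^ (q - 1)) ^ s * z := fun z => by
    rw [hd, pow_succ, ← pow_mul, mul_comm s]
  have hsum : x ^ q + y ^ q = 1 := by rw [← hadd, hxy, one_pow]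
  have hx0 : x ≠ 0 := by rintro rfl; exact hx (zero_pow (by omega))
  have hy0 : y ≠ 0 := by
    rintro rfl
    rw [add_zero] at hxy; subst hxy; exact hx (one_pow _)
  have hA := hU x hx0
  have hB := hU y hy0
  have hax := hqs x
  have hby := hqs y
  rw [hds, hds] at h
  have hconj := hadd ((x ^ (q - 1)) ^ s * x) ((y ^ (q - 1)) ^ s * y)
  rw [h, one_pow, mul_pow, mul_pow] at hconj
  rw [← hax, ← hby] at hsum hconj
  rw [← hax] at hx
  have key : ∀ a : K, a ^ (q + 1) = 1 → a ^ s * (a ^ s) ^ q = 1 := fun a ha => by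
    rw [← pow_succ', ← pow_mul, mul_comm, pow_mul, ha, one_pow]
  have hA' := key _ hA
  have hB' := key _ hB
  have hss : ∀ a : K, a ^ s = a ^ (s - 1) * a := fun a => by
    rw [← pow_succ]; congr 1; omega
  have hsa := hss (x ^ (q - 1))
  have hsb := hss (y ^ (q - 1))
  generalize x ^ (q - 1) = a at *
  generalize y ^ (q - 1) = b at *
  have ha1 : a ≠ 1 := by rintro rfl; exact hx (one_mul x)
  have hb1 : b ≠ 1 := by
    rintro rfl
    apply hx; linear_combination hsum - hxy
  have hab : a ≠ b := by
    rintro rfl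
    apply ha1; linear_combination hsum - a * hxy
  refine ⟨⟨hx0, hy0, ha1, hb1, hab, hsum⟩, ?_⟩
  generalize (a ^ s) ^ q = A' at *
  generalize (b ^ s) ^ q = B' at *
  have ha0 : a ≠ 0 := by rintro rfl; simp at hA
  have hb0 : b ≠ 0 := by rintro rfl; simp at hB
  generalize hAA : a ^ s = A at *
  generalize hBB : b ^ s = B at *
  have e1 : x * y * (A * B' * b + A' * B * a - a - b) = 0 := by
    linear_combination (A' * (a * x) + B' * (b * y)) * h - hconj - (a * x ^ 2) * hA' - b * y ^ 2 * hB'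
      - (a * x + b * y) * hxy - hsum
  have e2 : A * B' * b + A' * B * a - a - b = 0 := by simpa [hx0, hy0] using e1
  have e3 : (A - B) * (A * b - B * a) = 0 := by
    linear_combination A * B * e2 - A ^ 2 * b * hB' - B ^ 2 * a * hA'
  rcases mul_eq_zero.1 e3 with e | e
  · left
    have e' : A = B := sub_eq_zero.1 e
    subst e'
    have : A = 1 := by linear_combination h - A * hxy
    exact ⟨this, this⟩
  · right
    rw [hsa, hsb] at e
    have e' : a ^ (s-1) = b ^ (s-1) := by
      have : a * b * (a ^ (s-1) - b ^ (s-1)) = 0 := by linear_combination e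
      simpa [ha0, hb0, sub_eq_zero] using this
    rw [hsa, hsb, ← e'] at h
    have : a ^ (s-1) = 1 := by linear_combination h - a ^ (s-1) * hsum
    exact ⟨this, e' ▸ this⟩

theorem niho_bwd {K : Type} [Field K] (q s d : ℕ) (hq : 1 < q) (hs : 0 < s)
    (hd : d = s * (q - 1) + 1) (hsub : ∀ x y : K, (x - y) ^ q = x ^ q - y ^ q)
    (a b : K) (ha : a ^ (q + 1) = 1) (hb : b ^ (q + 1) = 1) (ha1 : a ≠ 1) (hb1 : b ≠ 1)
    (hab : a ≠ b) 
    (h : (a ^ s = 1 ∧ b ^ s = 1) ∨ (a ^ (s - 1) = 1 ∧ b ^ (s - 1) = 1)) :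
    ((1 - b) / (a - b)) ^ (q - 1) = a ∧ (1 - (1 - b) / (a - b)) ^ (q - 1) = b ∧
    ((1 - b) / (a - b)) ^ q ≠ (1 - b) / (a - b) ∧
    ((1 - b) / (a - b)) ^ d + (1 - (1 - b) / (a - b)) ^ d = 1 := by
  have hqs : ∀ z : K, z ^ q = z ^ (q - 1) * z := fun z => by
    rw [← pow_succ]; congr 1; omega
  have hds : ∀ z : K, z ^ d = (z ^ (q - 1)) ^ s * z := fun z => by
    rw [hd, pow_succ, ← pow_mul, mul_comm s]
  have hss : ∀ a : K, a ^ s = a ^ (s - 1) * a := fun a => by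
    rw [← pow_succ]; congr 1; omega
  have ha0 : a ≠ 0 := by rintro rfl; simp at ha
  have hb0 : b ≠ 0 := by rintro rfl; simp at hb
  have haq : a ^ q = a⁻¹ := by rw [pow_succ] at ha; exact eq_inv_of_mul_eq_one_left ha
  have hbq : b ^ q = b⁻¹ := by rw [pow_succ] at hb; exact eq_inv_of_mul_eq_one_left hb
  have hab' : a - b ≠ 0 := sub_ne_zero.2 hab
  have hba' : b - a ≠ 0 := sub_ne_zero.2 hab.symm
  have h1b : 1 - b ≠ 0 := sub_ne_zero.2 hb1.symm
  have ha1' : a - 1 ≠ 0 := sub_ne_zero.2 ha1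
  have hy : 1 - (1 - b) / (a - b) = (a - 1) / (a - b) := by field_simp; ring
  have hxq : ((1 - b) / (a - b)) ^ q = a * ((1 - b) / (a - b)) := by
    rw [div_pow, hsub, hsub, haq, hbq, one_pow]
    rw [show a⁻¹ - b⁻¹ = (b - a) / (a * b) by field_simp]
    field_simp
    ring
  have hyq : ((a - 1) / (a - b)) ^ q = b * ((a - 1) / (a - b)) := by
    rw [div_pow, hsub, hsub, haq, hbq, one_pow]
    rw [show a⁻¹ - b⁻¹ = (b - a) / (a * b) by field_simp]
    field_simp
    ring
  have hx0 : (1 - b) / (a - b) ≠ 0 := div_ne_zero h1b hab'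
  have hy0 : (a - 1) / (a - b) ≠ 0 := div_ne_zero ha1' hab'
  have hxa : ((1 - b) / (a - b)) ^ (q - 1) = a :=
    mul_right_cancel₀ hx0 (by rw [← hqs, hxq])
  have hyb : ((a - 1) / (a - b)) ^ (q - 1) = b :=
    mul_right_cancel₀ hy0 (by rw [← hqs, hyq])
  rw [hy]
  refine ⟨hxa, hyb, ?_, ?_⟩
  · rw [hxq]
    intro hh
    exact ha1 (mul_right_cancel₀ hx0 (by rw [hh, one_mul]))
  · rw [hds, hds, hxa, hyb]
    rcases h with ⟨h1, h2⟩ | ⟨h1, h2⟩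
    · rw [h1, h2]; field_simp; ring
    · rw [hss, hss b, h1, h2]; field_simp; ring

theorem niho_M {K : Type} [Field K] [Fintype K] [DecidableEq K] (q s d : ℕ) (hq : 1 < q)
    (hs : 0 < s) (hd : d = s * (q - 1) + 1) (hadd : ∀ x y : K, (x + y) ^ q = x ^ q + y ^ q)
    (hsub : ∀ x y : K, (x - y) ^ q = x ^ q - y ^ q)
    (hK : Fintype.card K = q ^ 2) :
    ((Finset.univ.filter (fun x : K => x ^ d + (1 - x) ^ d = 1)).card : ℂ)
      = q + ((Nat.gcd s (q + 1) : ℂ) - 1) * ((Nat.gcd s (q + 1) : ℂ) - 2)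
        + ((Nat.gcd (s - 1) (q + 1) : ℂ) - 1) * ((Nat.gcd (s - 1) (q + 1) : ℂ) - 2) := by
  have hf : (q - 1) * (q + 1) = q ^ 2 - 1 := by
    rw [mul_comm]; symm; simpa using Nat.sq_sub_sq q 1
  have hU : ∀ x : K, x ≠ 0 → (x ^ (q - 1)) ^ (q + 1) = 1 := fun x hx => by
    rw [← pow_mul, hf, ← hK]; exact FiniteField.pow_card_sub_one_eq_one x hx
  set S : ℕ → Finset K := fun t => Finset.univ.filter (fun x : K => x ^ t = 1 ∧ x ^ (q + 1) = 1)
    with hS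
  have hSc : ∀ t, ((((S t).erase 1).offDiag).card : ℂ)
      = ((Nat.gcd t (q + 1) : ℂ) - 1) * ((Nat.gcd t (q + 1) : ℂ) - 2) := by
    intro t
    have h1 : (1 : K) ∈ S t := by simp [hS]
    have hc : (S t).card = Nat.gcd t (q + 1) := niho_countS q t hq hK
    have hpos : 0 < Nat.gcd t (q + 1) := Nat.gcd_pos_of_pos_right _ (by omega)
    rw [Finset.offDiag_card, Finset.card_erase_of_mem h1, hc, Nat.cast_sub (Nat.le_mul_self _),
      Nat.cast_mul, Nat.cast_sub hpos]
    push_cast; ring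
  have hdisj : Disjoint (((S s).erase 1).offDiag) (((S (s - 1)).erase 1).offDiag) := by
    rw [Finset.disjoint_left]
    rintro ⟨a, b⟩ h1 h2
    simp only [hS, Finset.mem_offDiag, Finset.mem_erase, Finset.mem_filter, Finset.mem_univ,
      true_and] at h1 h2
    apply h1.1.1
    have e1 := h1.1.2.1
    have e2 := h2.1.2.1
    rwa [← Nat.sub_add_cancel hs, pow_succ, e2, one_mul] at e1
  rw [← hSc, ← hSc, add_assoc, ← Nat.cast_add, ← Finset.card_union_of_disjoint hdisj]
  have hF := niho_countF (K := K) q hq hK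
  rw [← Nat.cast_add]
  congr 1
  refine Eq.trans ?_ (congrArg (· + _) hF)
  rw [← Finset.card_filter_add_card_filter_not (s := Finset.univ.filter (fun x : K => x ^ d + (1 - x) ^ d = 1)) (fun x => x ^ q = x)]
  congr 1
  · congr 1
    ext x
    simp only [Finset.mem_filter, Finset.mem_univ, true_and, and_iff_right_iff_imp]
    intro hx
    have hz : ∀ z : K, z ^ q = z → z ^ d = z := by
      intro z hz
      by_cases h0 : z = 0
      · rw [h0, hd]; simp
      · have : z ^ (q - 1) = 1 := mul_right_cancel₀ h0 (by
          rw [← pow_succ, Nat.sub_add_cancel hq.le, hz, one_mul])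
        rw [hd, pow_succ, mul_comm s, pow_mul, this, one_pow, one_mul]
    rw [hz x hx, hz (1 - x) (by rw [hsub, one_pow, hx])]; ring
  · apply Finset.card_nbij' (fun x => (x ^ (q - 1), (1 - x) ^ (q - 1)))
      (fun c => (1 - c.2) / (c.1 - c.2))
    · intro x hx
      simp only [Finset.coe_filter, Finset.mem_filter, Finset.mem_univ, true_and, Set.mem_ofPred_eq] at hx
      obtain ⟨⟨h1, h2, h3, h4, h5, h6⟩, h7⟩ := niho_fwd q s d hq hs hd hadd hU x (1 - x) (by ring) hx.2 hx.1
      have u1 := hU x h1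
      have u2 := hU _ h2
      simp only [hS, Finset.coe_union, Set.mem_union, Finset.mem_coe, Finset.mem_offDiag, Finset.mem_erase, Finset.mem_filter, Finset.mem_univ, true_and]
      tauto
    · rintro ⟨a, b⟩ hc
      simp only [hS, Finset.coe_union, Set.mem_union, Finset.mem_coe, Finset.mem_offDiag, Finset.mem_erase, Finset.mem_filter, Finset.mem_univ, true_and] at hc
      obtain ⟨h1, h2, h3, h4⟩ := niho_bwd q s d hq hs hd hsub a b (by tauto) (by tauto) (by tauto) (by tauto) (by tauto) (by tauto)
      simp only [Finset.coe_filter, Finset.mem_filter, Finset.mem_univ, true_and, Set.mem_ofPred_eq]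
      exact ⟨h4, h3⟩
    · intro x hx
      simp only [Finset.coe_filter, Finset.mem_filter, Finset.mem_univ, true_and, Set.mem_ofPred_eq] at hx
      obtain ⟨⟨h1, h2, h3, h4, h5, h6⟩, h7⟩ := niho_fwd q s d hq hs hd hadd hU x (1 - x) (by ring) hx.2 hx.1
      have := sub_ne_zero.2 h5
      simp only
      rw [div_eq_iff this]
      linear_combination -h6
    · rintro ⟨a, b⟩ hc
      simp only [hS, Finset.coe_union, Set.mem_union, Finset.mem_coe, Finset.mem_offDiag, Finset.mem_erase, Finset.mem_filter, Finset.mem_univ, true_and] at hc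
      obtain ⟨h1, h2, h3, h4⟩ := niho_bwd q s d hq hs hd hsub a b (by tauto) (by tauto) (by tauto) (by tauto) (by tauto) (by tauto)
      simp only [h1, h2]
theorem niho_char {K : Type} [Field K] [Fintype K] [DecidableEq K] (ψ : AddChar K ℂ)
    (hψ : ψ.IsPrimitive) (d : ℕ) :
    ∑ u : K, ∑ v : K, (∑ x : K, ψ (u * x ^ d - v * x)) ^ 3
      = (Fintype.card K : ℂ) ^ 2 * ∑ z : K,
        ((Finset.univ.filter (fun x : K => x ^ d + (-z - x) ^ d + z ^ d = 0)).card : ℂ) := by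
  have h1 : ∀ u v : K, (∑ x : K, ψ (u * x ^ d - v * x)) ^ 3
      = ∑ z : K, ∑ x : K, ∑ y : K, ψ (u * (x ^ d + y ^ d + z ^ d)) * ψ (v * (-(x + y + z))) := by
    intro u v
    rw [pow_succ', pow_two, Finset.sum_mul_sum, Finset.sum_mul_sum]
    refine Finset.sum_congr rfl fun z _ => ?_
    simp only [Finset.mul_sum]
    refine Finset.sum_congr rfl fun x _ => Finset.sum_congr rfl fun y _ => ?_
    rw [← AddChar.map_add_eq_mul, ← AddChar.map_add_eq_mul, ← AddChar.map_add_eq_mul]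
    congr 1; ring
  simp only [h1]
  have h2 : ∑ u : K, ∑ v : K, ∑ z : K, ∑ x : K, ∑ y : K,
        ψ (u * (x ^ d + y ^ d + z ^ d)) * ψ (v * (-(x + y + z)))
      = ∑ z : K, ∑ x : K, ∑ y : K, (∑ u : K, ψ (u * (x ^ d + y ^ d + z ^ d))) *
          ∑ v : K, ψ (v * (-(x + y + z))) := by
    simp only [Finset.sum_mul_sum]
    simp only [← Finset.sum_product']
    simp only [Finset.univ_product_univ]
    exact Fintype.sum_equiv
      ⟨fun c => (c.2.2.1, c.2.2.2.1, c.2.2.2.2, c.1, c.2.1),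
       fun c => (c.2.2.2.1, c.2.2.2.2, c.1, c.2.1, c.2.2.1), fun _ => rfl, fun _ => rfl⟩
      _ _ (fun _ => rfl)
  rw [h2]
  rw [Finset.mul_sum]
  refine Finset.sum_congr rfl fun z _ => ?_
  rw [Finset.card_filter]
  push_cast
  rw [Finset.mul_sum]
  refine Finset.sum_congr rfl fun x _ => ?_
  rw [Finset.sum_eq_single (-z - x)]
  · rw [AddChar.sum_mulShift _ hψ, AddChar.sum_mulShift _ hψ]
    rw [if_pos (show -(x + (-z - x) + z) = 0 by ring)]
    split_ifs <;> push_cast <;> ring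
  · intro y _ hy
    rw [AddChar.sum_mulShift (-(x + y + z)) hψ, if_neg]
    · simp
    · intro h; apply hy; linear_combination -h
  · simp

theorem niho_N {K : Type} [Field K] [Fintype K] [DecidableEq K] (d : ℕ) (hd : 0 < d)
    (hneg : (-1 : K) ^ d = -1) :
    ∑ z : K, ((Finset.univ.filter (fun x : K => x ^ d + (-z - x) ^ d + z ^ d = 0)).card : ℂ)
      = Fintype.card K + (Fintype.card K - 1) *
        ((Finset.univ.filter (fun x : K => x ^ d + (1 - x) ^ d = 1)).card : ℂ) := by
  have hn : ∀ z : K, (-z) ^ d = - z ^ d := fun z => by rw [neg_pow, hneg]; ring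
  rw [← Finset.add_sum_erase _ _ (Finset.mem_univ 0)]
  congr 1
  · rw [Finset.filter_true_of_mem]
    · simp
    · intro x _; simp [hn, hd.ne']
  · have : ∀ z ∈ (Finset.univ.erase (0:K)),
      ((Finset.univ.filter (fun x : K => x ^ d + (-z - x) ^ d + z ^ d = 0)).card : ℂ)
       = ((Finset.univ.filter (fun x : K => x ^ d + (1 - x) ^ d = 1)).card : ℂ) := by
      intro z hz
      have hz0 : z ≠ 0 := by simpa using hz
      have hzd : z ^ d ≠ 0 := pow_ne_zero _ hz0
      congr 1
      symm
      apply Finset.card_nbij' (fun x => (-z) * x) (fun x => x / (-z))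
      · intro x hx
        simp only [Finset.coe_filter, Finset.mem_univ, true_and, Set.mem_ofPred_eq] at hx ⊢
        rw [show -z - -z * x = -z * (1 - x) by ring, mul_pow, mul_pow, hn]
        linear_combination - z ^ d * hx
      · intro x hx
        simp only [Finset.coe_filter, Finset.mem_univ, true_and, Set.mem_ofPred_eq] at hx ⊢
        rw [show 1 - x / (-z) = (-z - x) / (-z) by field_simp; ring, div_pow, div_pow, hn,
          ← add_div, div_eq_one_iff_eq (neg_ne_zero.2 hzd)]
        linear_combination hx
      · intro x _; simp only; field_simp
      · intro x _; simp only; field_simp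
    rw [Finset.sum_congr rfl this, Finset.sum_const, Finset.card_erase_of_mem (Finset.mem_univ _),
      nsmul_eq_mul, Finset.card_univ, Nat.cast_sub Fintype.card_pos]
    simp


/-- third power-moment of the Walsh transform of the Niho power
function `F(x) = x^(s(p^m-1)+1)` over `K = GF(p^n)`, `n = 2m`:
`Σ_{u,v} W_F(u,v)³ = p^(2n)·(3p^n - 2 + (p^n-1)(p^m + (s₁-1)(s₁-2) + (s₂-1)(s₂-2) - 2))`. -/
theorem stmt_8 (p m s : ℕ) [Fact p.Prime] (hm : 0 < m) (hs : 0 < s)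
    (K : Type) [Field K] [Fintype K] [Algebra (ZMod p) K]
    (hK : Fintype.card K = p ^ (2 * m))
    (d : ℕ) (hd : d = s * (p ^ m - 1) + 1)
    (W : K → K → ℂ)
    (hW : ∀ u v : K, W u v = ∑ x : K,
      Complex.exp (2 * (Real.pi : ℂ) * Complex.I / (p : ℂ)) ^
        (Algebra.trace (ZMod p) K (u * x ^ d - v * x)).val) :
    ∑ u : K, ∑ v : K, W u v ^ 3
      = (p : ℂ) ^ (2 * (2 * m)) *
          (3 * (p : ℂ) ^ (2 * m) - 2
            + ((p : ℂ) ^ (2 * m) - 1) *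
                ((p : ℂ) ^ m
                  + ((Nat.gcd s (p ^ m + 1) : ℂ) - 1) * ((Nat.gcd s (p ^ m + 1) : ℂ) - 2)
                  + ((Nat.gcd (s - 1) (p ^ m + 1) : ℂ) - 1) *
                      ((Nat.gcd (s - 1) (p ^ m + 1) : ℂ) - 2)
                  - 2)) := by
  classical
  have hp : p.Prime := Fact.out
  haveI : NeZero p := ⟨hp.ne_zero⟩
  haveI : CharP K p := charP_of_injective_algebraMap (algebraMap (ZMod p) K).injective p
  have hq : 1 < p ^ m := Nat.one_lt_pow hm.ne' hp.one_lt
  have hK2 : Fintype.card K = (p ^ m) ^ 2 := by rw [hK, ← pow_mul, mul_comm]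
  haveI : Algebra.IsSeparable (ZMod p) K := inferInstance
  let ψ : AddChar K ℂ :=
    (ZMod.stdAddChar (N := p)).compAddMonoidHom (Algebra.trace (ZMod p) K).toAddMonoidHom
  have hψa : ∀ t : K, ψ t = Complex.exp (2 * (Real.pi : ℂ) * Complex.I / (p : ℂ)) ^
      (Algebra.trace (ZMod p) K t).val := by
    intro t
    change ZMod.stdAddChar (Algebra.trace (ZMod p) K t) = _
    rw [ZMod.stdAddChar_apply, ZMod.toCircle_apply, ← Complex.exp_nat_mul]
    congr 1
    ring
  have hψ : ψ.IsPrimitive := by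
    apply AddChar.IsPrimitive.of_ne_one
    intro h
    obtain ⟨t, ht⟩ := Algebra.trace_surjective (ZMod p) K 1
    have h1 : ZMod.stdAddChar (Algebra.trace (ZMod p) K t) = (1 : ℂ) := by
      change ψ t = 1
      rw [h]; rfl
    rw [ht, ← AddChar.map_zero_eq_one (ZMod.stdAddChar (N := p))] at h1
    exact one_ne_zero (ZMod.injective_stdAddChar h1)
  have hneg : (-1 : K) ^ d = -1 := by
    have h0 : (-1 : K) ^ (p ^ m) = -1 := neg_one_pow_char_pow ..
    have h1 : (-1 : K) ^ (p ^ m - 1) = 1 := by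
      have : (-1 : K) ^ (p ^ m - 1) * (-1) = 1 * (-1) := by
        rw [← pow_succ, Nat.sub_add_cancel hq.le, h0, one_mul]
      exact mul_right_cancel₀ (by simp) this
    rw [hd, pow_succ, mul_comm s, pow_mul, h1, one_pow, one_mul]
  simp only [hW, ← hψa]
  rw [niho_char ψ hψ d, niho_N d (by omega) hneg,
    niho_M (p ^ m) s d hq hs hd (fun x y => add_pow_char_pow ..) (fun x y => sub_pow_char_pow ..) hK2,
    hK]
  push_cast
  ring
end
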